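/- In a two-dimensional normed space, if every pair of Birkhoff orthogonal unit vectors is also isosceles orthogonal (‖x+y‖ = ‖x−y‖), then the norm is induced by an inner product. -/

import Mathlib

open Filter Topology Metric

section TwoDimensional

variable {X : Type*} [NormedAddCommGroup X] [NormedSpace ℝ X]

lemma coeff_eq_zero_of_isosceles {x y z : X} (hx : ‖x‖ = 1) (hy : ‖y‖ = 1) (hz : ‖z‖ = 1)
    (hxy : ‖x + y‖ = ‖x - y‖) (hxz : ‖x + z‖ = ‖x - z‖) {a b : ℝ} (ha : 0 ≤ a) (hb : 0 ≤ b)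
    (h : y = a • x + b • z) : a = 0 := by
  by_contra hne
  have ha' : 0 < a := lt_of_le_of_ne ha (Ne.symm hne)
  have nx (s : ℝ) : ‖s • x‖ = |s| := by rw [norm_smul, hx, mul_one, Real.norm_eq_abs]
  have ny (s : ℝ) : ‖s • y‖ = |s| := by rw [norm_smul, hy, mul_one, Real.norm_eq_abs]
  have nz (s : ℝ) : ‖s • z‖ = |s| := by rw [norm_smul, hz, mul_one, Real.norm_eq_abs]
  have nn {s : ℝ} (hs : 0 ≤ s) (v : X) : ‖s • v‖ = s * ‖v‖ := by
    rw [norm_smul, Real.norm_eq_abs, abs_of_nonneg hs]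
  have hab : 1 ≤ a + b := by
    have := norm_add_le (a • x) (b • z)
    rwa [← h, hy, nx, nz, abs_of_nonneg ha, abs_of_nonneg hb] at this
  have hba : b ≤ 1 + a := by
    have h1 : b • z = y - a • x := by rw [h]; abel
    have := norm_sub_le y (a • x)
    rwa [← h1, hy, nx, nz, abs_of_nonneg ha, abs_of_nonneg hb] at this
  have h1 : (a + b) * ‖x - y‖ ≤ b * ‖x - z‖ + (a + b - 1) := by
    have e : (a + b) • (x - y) = b • (x - z) - (a + b - 1) • y := by
      have : b • z = y - a • x := by rw [h]; abel
      rw [smul_sub b, this]; module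
    have := norm_sub_le (b • (x - z)) ((a + b - 1) • y)
    rwa [← e, nn (by linarith), nn hb, ny, abs_of_nonneg (by linarith)] at this
  have h2 : a + b ≤ a * ‖x - z‖ + 1 := by
    have e : (a + b) • z = y - a • (x - z) := by rw [h]; module
    have := norm_sub_le y (a • (x - z))
    rw [← e, hy, nn ha, nz, abs_of_nonneg (by linarith)] at this
    linarith
  have h3 : (1 + a) * ‖x - z‖ ≤ ‖x - y‖ + (1 + a - b) := by
    have e : (1 + a) • (x + z) = (x + y) + (1 + a - b) • z := by rw [h]; module
    have := norm_add_le (x + y) ((1 + a - b) • z)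
    rwa [← e, nn (by linarith), nz, abs_of_nonneg (by linarith), hxy, hxz] at this
  have h4 : 1 + a ≤ a * ‖x - y‖ + b := by
    have e : (1 + a) • y = a • (x + y) + b • z := by
      have : b • z = y - a • x := by rw [h]; abel
      rw [this]; module
    have := norm_add_le (a • (x + y)) (b • z)
    rwa [← e, nn ha, ny, nz, abs_of_nonneg hb, abs_of_nonneg (by linarith), hxy] at this
  have hrs : ‖x - z‖ ≤ ‖x - y‖ := by
    refine le_of_mul_le_mul_left ?_ (show 0 < 1 + a by linarith)
    linarith
  have hsr : ‖x - y‖ ≤ ‖x - z‖ := by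
    refine le_of_mul_le_mul_left ?_ (show 0 < a + b by linarith)
    linarith
  have hr : ‖x - z‖ = ‖x - y‖ := le_antisymm hrs hsr
  rw [hr] at h1 h2 h3
  have hb1 : b = 1 := by linarith
  have hs1 : ‖x - y‖ = 1 := by
    refine mul_left_cancel₀ hne ?_
    rw [hb1] at h2 h3 h4
    linarith
  have e : (x + y) + (x - z) = (2 + a) • x := by rw [h, hb1]; module
  have := norm_add_le (x + y) (x - z)
  rw [e, nx, abs_of_nonneg (by linarith), hxy, hr, hs1] at this
  linarith

lemma eq_or_eq_neg_of_isosceles {x y z : X} (hx : ‖x‖ = 1) (hy : ‖y‖ = 1) (hz : ‖z‖ = 1)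
    (hxy : ‖x + y‖ = ‖x - y‖) (hxz : ‖x + z‖ = ‖x - z‖) {a b : ℝ}
    (h : y = a • x + b • z) : y = z ∨ y = -z := by
  have hz' : ‖-z‖ = 1 := by rwa [norm_neg]
  have hy' : ‖-y‖ = 1 := by rwa [norm_neg]
  have hxz' : ‖x + -z‖ = ‖x - -z‖ := by rw [← sub_eq_add_neg, sub_neg_eq_add, hxz]
  have hxy' : ‖x + -y‖ = ‖x - -y‖ := by rw [← sub_eq_add_neg, sub_neg_eq_add, hxy]
  have ha : a = 0 := by
    rcases le_total 0 a with ha | ha <;> rcases le_total 0 b with hb | hb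
    · exact coeff_eq_zero_of_isosceles hx hy hz hxy hxz ha hb h
    · exact coeff_eq_zero_of_isosceles hx hy hz' hxy hxz' ha (neg_nonneg.2 hb) (by rw [h]; module)
    · exact neg_eq_zero.1 (coeff_eq_zero_of_isosceles hx hy' hz' hxy' hxz' (neg_nonneg.2 ha) hb
        (by rw [h]; module))
    · exact neg_eq_zero.1 (coeff_eq_zero_of_isosceles hx hy' hz hxy' hxz (neg_nonneg.2 ha)
        (neg_nonneg.2 hb) (by rw [h]; module))
  rw [ha, zero_smul, zero_add] at h
  have hb : |b| = 1 := by rw [h, norm_smul, hz, mul_one, Real.norm_eq_abs] at hy; exact hy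
  rcases eq_or_eq_neg_of_abs_eq hb with hb | hb
  · left; rw [h, hb, one_smul]
  · right; rw [h, hb, neg_smul, one_smul]

/-- An area form on a real normed plane. -/
structure IsAreaForm (D : X →L[ℝ] X →L[ℝ] ℝ) : Prop where
  self_eq_zero : ∀ u, D u u = 0
  smul_eq : ∀ u v w, D u v • w = D w v • u + D u w • v
  exists_ne_zero : ∀ u, u ≠ 0 → ∃ w, D u w ≠ 0

namespace IsAreaForm

variable {D : X →L[ℝ] X →L[ℝ] ℝ}

lemma neg_swap (hD : IsAreaForm D) (u v : X) : D v u = -D u v := by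
  have h := hD.self_eq_zero (u + v)
  simp only [map_add, add_apply, hD.self_eq_zero] at h
  linarith

lemma const_smul (hD : IsAreaForm D) {c : ℝ} (hc : c ≠ 0) : IsAreaForm (c • D) where
  self_eq_zero u := by simp [hD.self_eq_zero]
  smul_eq u v w := by
    simp only [smul_apply, smul_eq_mul, mul_smul]
    rw [hD.smul_eq u v w, smul_add]
  exists_ne_zero u hu := by
    obtain ⟨w, hw⟩ := hD.exists_ne_zero u hu
    exact ⟨w, by simp [hc, hw]⟩

lemma ne_zero_of_isosceles (hD : IsAreaForm D) {x y : X} (hx : ‖x‖ = 1) (hy : ‖y‖ = 1)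
    (hxy : ‖x + y‖ = ‖x - y‖) : D x y ≠ 0 := by
  intro h
  have hx0 : x ≠ 0 := by rintro rfl; simp at hx
  obtain ⟨w, hw⟩ := hD.exists_ne_zero x hx0
  have e := hD.smul_eq x y w
  rw [h, zero_smul] at e
  have hy_eq : y = (-(D w y) / D x w) • x := by
    have : D x w • y = (-(D w y)) • x := by
      rw [neg_smul]; exact eq_neg_of_add_eq_zero_right e.symm
    rw [div_eq_inv_mul, mul_smul, ← this, smul_smul, inv_mul_cancel₀ hw, one_smul]
  have hs : |-(D w y) / D x w| = 1 := by
    rw [hy_eq, norm_smul, hx, mul_one, Real.norm_eq_abs] at hy; exact hy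
  rcases eq_or_eq_neg_of_abs_eq hs with hs | hs <;> rw [hs] at hy_eq <;> rw [hy_eq] at hxy
  · rw [one_smul, sub_self, norm_zero, ← two_smul ℝ, norm_smul, hx] at hxy
    norm_num at hxy
  · rw [neg_smul, one_smul, add_neg_cancel, norm_zero, sub_neg_eq_add, ← two_smul ℝ, norm_smul,
      hx] at hxy
    norm_num at hxy

lemma eq_or_eq_neg_of_isosceles (hD : IsAreaForm D) {x y z : X} (hx : ‖x‖ = 1) (hy : ‖y‖ = 1)
    (hz : ‖z‖ = 1) (hxy : ‖x + y‖ = ‖x - y‖) (hxz : ‖x + z‖ = ‖x - z‖) : y = z ∨ y = -z := by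
  have h0 := hD.ne_zero_of_isosceles hx hz hxz
  refine _root_.eq_or_eq_neg_of_isosceles hx hy hz hxy hxz
    (a := (D x z)⁻¹ * D y z) (b := (D x z)⁻¹ * D x y) ?_
  rw [mul_smul, mul_smul, ← smul_add, ← hD.smul_eq, smul_smul, inv_mul_cancel₀ h0, one_smul]

lemma exists_birkhoff (hD : IsAreaForm D) {x : X} (hx : ‖x‖ = 1) :
    ∃ y : X, ‖y‖ = 1 ∧ ∀ t : ℝ, ‖x‖ ≤ ‖x + t • y‖ := by
  have hx0 : x ≠ 0 := by rintro rfl; simp at hx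
  obtain ⟨g, hg, hgx⟩ := exists_dual_vector ℝ x (by rw [hx]; norm_num)
  obtain ⟨w, hw⟩ := hD.exists_ne_zero x hx0
  have hgx' : g x = 1 := by rw [hgx, hx]; simp
  set v := w - g w • x with hv
  have hv0 : v ≠ 0 := by
    intro h
    have : D x v = D x w := by simp [hv, hD.self_eq_zero]
    rw [h, map_zero] at this
    exact hw this.symm
  have hgv : g v = 0 := by simp [hv, hgx']
  refine ⟨‖v‖⁻¹ • v, by rw [norm_smul, norm_inv, norm_norm, inv_mul_cancel₀ (norm_ne_zero_iff.2 hv0)],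
    fun t ↦ ?_⟩
  have h := g.le_opNorm (x + t • ‖v‖⁻¹ • v)
  rw [hg, one_mul] at h
  simpa [hgv, hgx', hx] using h

lemma abs_le_of_birkhoff (hD : IsAreaForm D) {x y : X} (hx : ‖x‖ = 1)
    (hxy : ∀ t : ℝ, ‖x‖ ≤ ‖x + t • y‖) (u : X) : |D u y| ≤ |D x y| * ‖u‖ := by
  rw [← Real.norm_eq_abs (D x y), ← norm_smul, hD.smul_eq x y u]
  by_cases h : D u y = 0
  · rw [h, abs_zero]; exact norm_nonneg _
  · have e : D u y • x + D x u • y = D u y • (x + ((D u y)⁻¹ * D x u) • y) := by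
      rw [smul_add, smul_smul, mul_inv_cancel_left₀ h]
    rw [e, norm_smul, Real.norm_eq_abs]
    have := hxy ((D u y)⁻¹ * D x u)
    rw [hx] at this
    nlinarith [abs_nonneg (D u y)]

end IsAreaForm

lemma exists_isAreaForm (hdim : Module.finrank ℝ X = 2) :
    ∃ D : X →L[ℝ] X →L[ℝ] ℝ, IsAreaForm D := by
  have : FiniteDimensional ℝ X := Module.finite_of_finrank_eq_succ hdim
  let b := Module.finBasisOfFinrankEq ℝ X hdim
  let p : X →L[ℝ] ℝ := LinearMap.toContinuousLinearMap (b.coord 0)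
  let q : X →L[ℝ] ℝ := LinearMap.toContinuousLinearMap (b.coord 1)
  have hpq (u v : X) (h0 : p u = p v) (h1 : q u = q v) : u = v := by
    refine b.ext_elem fun i ↦ ?_
    fin_cases i
    · exact h0
    · exact h1
  have hp0 : p (b 0) = 1 := by simp [p]
  have hp1 : p (b 1) = 0 := by simp [p]
  have hq0 : q (b 0) = 0 := by simp [q]
  have hq1 : q (b 1) = 1 := by simp [q]
  have hD (u v : X) : (p.smulRight q - q.smulRight p) u v = p u * q v - q u * p v := by simp
  refine ⟨p.smulRight q - q.smulRight p, ⟨fun u ↦ ?_, fun u v w ↦ ?_, fun u hu ↦ ?_⟩⟩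
  · rw [hD]; ring
  · simp only [hD]
    apply hpq <;> simp only [map_add, map_smul, smul_eq_mul] <;> ring
  · by_contra! h
    apply hu
    have h0 := h (b 0)
    have h1 := h (b 1)
    rw [hD, hp0, hq0] at h0
    rw [hD, hp1, hq1] at h1
    apply hpq <;> rw [map_zero] <;> linarith

/-- A function on the unit sphere whose increments are of higher order is constant. -/
lemma eq_of_isLittleO_sphere (hdim : Module.finrank ℝ X = 2) {f : X → ℝ}
    (hf : ∀ x : X, ‖x‖ = 1 →
      (fun z ↦ f z - f x) =o[𝓝[sphere 0 1] x] fun z ↦ z - x)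
    {x z : X} (hx : ‖x‖ = 1) (hz : ‖z‖ = 1) : f x = f z := by
  have : FiniteDimensional ℝ X := Module.finite_of_finrank_eq_succ hdim
  have hrank : 1 < Module.rank ℝ X := by
    rw [← Module.finrank_eq_rank, hdim]; norm_num
  let n : X → X := fun v ↦ ‖v‖⁻¹ • v
  have hn (v : X) (hv : v ≠ 0) : ‖n v‖ = 1 := by
    simp only [n]
    rw [norm_smul, norm_inv, norm_norm, inv_mul_cancel₀ (norm_ne_zero_iff.2 hv)]
  have hn1 (v : X) (hv : ‖v‖ = 1) : n v = v := by simp [n, hv]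
  have hbound (v w : X) (hv : v ≠ 0) (hw : w ≠ 0) : ‖n w - n v‖ ≤ 2 * ‖v‖⁻¹ * ‖w - v‖ := by
    have hv' := norm_pos_iff.2 hv
    have hw' := norm_pos_iff.2 hw
    have e : n w - n v = ‖v‖⁻¹ • ((w - v) + (‖v‖ - ‖w‖) • n w) := by
      simp only [n]
      rw [smul_smul, sub_mul, mul_inv_cancel₀ hw'.ne', sub_smul, one_smul, mul_smul, smul_add,
        smul_sub, smul_sub, smul_smul, inv_mul_cancel₀ hv'.ne']
      module
    rw [e, norm_smul, norm_inv, norm_norm, mul_comm (2 : ℝ), mul_assoc]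
    refine mul_le_mul_of_nonneg_left ?_ (inv_nonneg.2 hv'.le)
    have h1 := norm_add_le (w - v) ((‖v‖ - ‖w‖) • n w)
    rw [norm_smul, hn w hw, mul_one, Real.norm_eq_abs] at h1
    have h2 := abs_norm_sub_norm_le v w
    rw [norm_sub_rev] at h2
    linarith
  have hderiv (v : X) (hv : v ≠ 0) : HasFDerivAt (f ∘ n) (0 : X →L[ℝ] ℝ) v := by
    rw [hasFDerivAt_iff_isLittleO]
    have hev : ∀ᶠ w in 𝓝 v, w ≠ 0 := isOpen_ne.mem_nhds hv
    have ht : Tendsto n (𝓝 v) (𝓝[sphere 0 1] (n v)) := by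
      refine tendsto_nhdsWithin_iff.2 ⟨?_, hev.mono fun w hw ↦ by simpa using hn w hw⟩
      exact ((continuousAt_id.norm).inv₀ (norm_ne_zero_iff.2 hv)).smul continuousAt_id
    have h1 := (hf (n v) (hn v hv)).comp_tendsto ht
    have h2 : ((fun z ↦ z - n v) ∘ n) =O[𝓝 v] fun w ↦ w - v :=
      Asymptotics.IsBigO.of_bound _ (hev.mono fun w hw ↦ hbound v w hv hw)
    simpa [Function.comp_def] using h1.trans_isBigO h2
  have hopen : IsOpen ({0}ᶜ : Set X) := isOpen_compl_singleton
  have hconn : IsPreconnected ({0}ᶜ : Set X) :=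
    (isConnected_compl_singleton_of_one_lt_rank hrank 0).isPreconnected
  have h := hopen.is_const_of_fderiv_eq_zero (𝕜 := ℝ) (f := f ∘ n) hconn
    (fun v hv ↦ (hderiv v hv).differentiableAt.differentiableWithinAt)
    (fun v hv ↦ (hderiv v hv).fderiv)
    (x := x) (y := z) (by rintro rfl; simp at hx) (by rintro rfl; simp at hz)
  simpa [hn1 x hx, hn1 z hz] using h

lemma abs_frame_defect_le {e₁ e₂ d h : ℝ} (he₁ : 0 ≤ e₁) (he₂ : 0 ≤ e₂) (hh : |h| ≤ e₁ + e₂)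
    (hdet : (1 - e₁) * (1 - e₂) + d * (d + h) = 1) (hsmall : e₁ + |d| ≤ 1 / 2) (A B : ℝ) :
    |((-(d + h) * A + (1 - e₂) * B) ^ 2 + ((1 - e₁) * A + d * B) ^ 2) - (B ^ 2 + A ^ 2)| ≤
      20 * (|A| + |B|) ^ 2 * d ^ 2 := by
  have hd0 := abs_nonneg d
  have hd1 : |d| ≤ 1 / 2 := by linarith
  have hdd : d ^ 2 = |d| ^ 2 := (sq_abs d).symm
  have hE : e₁ + e₂ ≤ 2 * d ^ 2 := by
    have h1 : d * h ≤ |d| * (e₁ + e₂) :=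
      (le_abs_self _).trans (by rw [abs_mul]; exact mul_le_mul_of_nonneg_left hh hd0)
    have h2 : (e₁ + |d|) * (e₁ + e₂) ≤ 1 / 2 * (e₁ + e₂) :=
      mul_le_mul_of_nonneg_right hsmall (by linarith)
    nlinarith [sq_nonneg e₁]
  have hdsq : d ^ 2 ≤ |d| / 2 := by rw [hdd]; nlinarith
  have hk : |d + h| ≤ 2 * |d| := (abs_add_le d h).trans (by linarith)
  have hk2 : (d + h) ^ 2 ≤ 4 * d ^ 2 := by
    rw [← sq_abs (d + h), hdd]
    nlinarith [abs_nonneg (d + h)]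
  have hA : |(d + h) ^ 2 - 2 * e₁ + e₁ ^ 2| ≤ 20 * d ^ 2 := by
    rw [abs_le]; constructor <;> nlinarith [sq_nonneg (d + h)]
  have hB : |d ^ 2 - 2 * e₂ + e₂ ^ 2| ≤ 20 * d ^ 2 := by
    rw [abs_le]; constructor <;> nlinarith
  have hAB : |-(e₁ * d) - h + e₂ * (d + h)| ≤ 20 * d ^ 2 := by
    have h1 : |e₁ * d| ≤ 2 * d ^ 2 := by
      rw [abs_mul, abs_of_nonneg he₁]; nlinarith
    have h2 : |e₂ * (d + h)| ≤ 2 * d ^ 2 := by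
      rw [abs_mul, abs_of_nonneg he₂]; nlinarith [abs_nonneg (d + h)]
    rw [abs_le] at h1 h2 hh ⊢
    constructor <;> linarith [h1.1, h1.2, h2.1, h2.2, hh.1, hh.2]
  have e : ((-(d + h) * A + (1 - e₂) * B) ^ 2 + ((1 - e₁) * A + d * B) ^ 2) - (B ^ 2 + A ^ 2) =
      ((d + h) ^ 2 - 2 * e₁ + e₁ ^ 2) * A ^ 2 + (d ^ 2 - 2 * e₂ + e₂ ^ 2) * B ^ 2 +
        (-(e₁ * d) - h + e₂ * (d + h)) * (2 * (A * B)) := by ring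
  rw [e]
  refine (abs_add_three _ _ _).trans ?_
  simp only [abs_mul, abs_two, abs_sq, ← sq_abs A, ← sq_abs B]
  have i1 := mul_le_mul_of_nonneg_right hA (sq_nonneg |A|)
  have i2 := mul_le_mul_of_nonneg_right hB (sq_nonneg |B|)
  have i3 := mul_le_mul_of_nonneg_right hAB (show 0 ≤ 2 * (|A| * |B|) by positivity)
  linarith

/-- `J` sends each unit vector to the positively oriented unit vector that is both isosceles
orthogonal and Birkhoff orthogonal to it. -/
structure IsConjugation (D : X →L[ℝ] X →L[ℝ] ℝ) (J : X → X) : Prop where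
  norm_eq : ∀ x, ‖x‖ = 1 → ‖J x‖ = 1
  pos : ∀ x, ‖x‖ = 1 → 0 < D x (J x)
  isosceles : ∀ x, ‖x‖ = 1 → ‖x + J x‖ = ‖x - J x‖
  abs_le : ∀ x, ‖x‖ = 1 → ∀ u, |D u (J x)| ≤ D x (J x) * ‖u‖

lemma IsAreaForm.exists_isConjugation {D : X →L[ℝ] X →L[ℝ] ℝ} (hD : IsAreaForm D)
    (H : ∀ x y : X, ‖x‖ = 1 → ‖y‖ = 1 →
      (∀ t : ℝ, ‖x‖ ≤ ‖x + t • y‖) → ‖x + y‖ = ‖x - y‖) :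
    ∃ J : X → X, IsConjugation D J := by
  have key (x : X) : ∃ y : X, ‖x‖ = 1 → ‖y‖ = 1 ∧ 0 < D x y ∧ ‖x + y‖ = ‖x - y‖ ∧
      ∀ u, |D u y| ≤ D x y * ‖u‖ := by
    by_cases hx : ‖x‖ = 1
    swap
    · exact ⟨0, fun h ↦ absurd h hx⟩
    obtain ⟨y, hy, hxy⟩ := hD.exists_birkhoff hx
    have hiso := H x y hx hy hxy
    have hle := hD.abs_le_of_birkhoff hx hxy
    rcases lt_or_gt_of_ne (hD.ne_zero_of_isosceles hx hy hiso) with h | h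
    · refine ⟨-y, fun _ ↦ ⟨by rwa [norm_neg], by rw [map_neg]; linarith, ?_, fun u ↦ ?_⟩⟩
      · rw [← sub_eq_add_neg, sub_neg_eq_add, hiso]
      · rw [map_neg, map_neg, abs_neg, ← abs_of_neg h]; exact hle u
    · refine ⟨y, fun _ ↦ ⟨hy, h, hiso, fun u ↦ ?_⟩⟩
      rw [← abs_of_pos h]; exact hle u
  choose J hJ using key
  exact ⟨J, fun x hx ↦ (hJ x hx).1, fun x hx ↦ (hJ x hx).2.1, fun x hx ↦ (hJ x hx).2.2.1,
    fun x hx ↦ (hJ x hx).2.2.2⟩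

namespace IsConjugation

variable {D : X →L[ℝ] X →L[ℝ] ℝ} {J : X → X}

lemma const_smul (hJ : IsConjugation D J) {c : ℝ} (hc : 0 < c) : IsConjugation (c • D) J where
  norm_eq := hJ.norm_eq
  pos x hx := by
    simp only [smul_apply, smul_eq_mul]
    exact mul_pos hc (hJ.pos x hx)
  isosceles := hJ.isosceles
  abs_le x hx u := by
    simp only [smul_apply, smul_eq_mul]
    rw [abs_mul, abs_of_pos hc, mul_assoc]
    exact mul_le_mul_of_nonneg_left (hJ.abs_le x hx u) hc.le

lemma eq_of_isosceles (hJ : IsConjugation D J) (hD : IsAreaForm D) {x y : X} (hx : ‖x‖ = 1)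
    (hy : ‖y‖ = 1) (hxy : ‖x + y‖ = ‖x - y‖) (h : 0 ≤ D x y) : J x = y := by
  rcases hD.eq_or_eq_neg_of_isosceles hx (hJ.norm_eq x hx) hy (hJ.isosceles x hx) hxy with e | e
  · exact e
  · have := hJ.pos x hx
    rw [e, map_neg] at this
    linarith

lemma apply_apply (hJ : IsConjugation D J) (hD : IsAreaForm D) {x : X} (hx : ‖x‖ = 1) :
    J (J x) = -x := by
  refine hJ.eq_of_isosceles hD (hJ.norm_eq x hx) (by rwa [norm_neg]) ?_ ?_
  · rw [← sub_eq_add_neg, sub_neg_eq_add, norm_sub_rev, add_comm, hJ.isosceles x hx]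
  · rw [map_neg, hD.neg_swap x, neg_neg]
    exact (hJ.pos x hx).le

lemma abs_le_left (hJ : IsConjugation D J) (hD : IsAreaForm D) {x : X} (hx : ‖x‖ = 1) (u : X) :
    |D x u| ≤ D x (J x) * ‖u‖ := by
  have h := hJ.abs_le (J x) (hJ.norm_eq x hx) u
  rwa [hJ.apply_apply hD hx, map_neg, map_neg, abs_neg, hD.neg_swap x u, abs_neg,
    hD.neg_swap x (J x), neg_neg] at h

lemma norm_add_pos (hJ : IsConjugation D J) {x : X} (hx : ‖x‖ = 1) :
    0 < ‖x + J x‖ := by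
  by_contra! h
  have h0 : ‖x + J x‖ = 0 := le_antisymm h (norm_nonneg _)
  have h1 := hJ.isosceles x hx
  have h2 := norm_add_le (x + J x) (x - J x)
  have e : (x + J x) + (x - J x) = (2 : ℝ) • x := by module
  rw [e, norm_smul, hx, ← h1, h0] at h2
  norm_num at h2

lemma norm_diagonal (hJ : IsConjugation D J) {x : X} (hx : ‖x‖ = 1) :
    ‖‖x + J x‖⁻¹ • (x + J x)‖ = 1 := by
  rw [norm_smul, norm_inv, norm_norm, inv_mul_cancel₀ (hJ.norm_add_pos hx).ne']

lemma apply_diagonal (hJ : IsConjugation D J) (hD : IsAreaForm D) {x : X} (hx : ‖x‖ = 1) :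
    J (‖x + J x‖⁻¹ • (x + J x)) = ‖x + J x‖⁻¹ • (J x - x) := by
  have hr := hJ.norm_add_pos hx
  refine hJ.eq_of_isosceles hD (hJ.norm_diagonal hx) ?_ ?_ ?_
  · rw [norm_smul, norm_inv, norm_norm, norm_sub_rev, ← hJ.isosceles x hx, inv_mul_cancel₀ hr.ne']
  · rw [← smul_add, ← smul_sub, norm_smul, norm_smul]
    have e1 : x + J x + (J x - x) = (2 : ℝ) • J x := by module
    have e2 : x + J x - (J x - x) = (2 : ℝ) • x := by module
    rw [e1, e2, norm_smul, norm_smul, hx, hJ.norm_eq x hx]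
  · have h := hJ.pos x hx
    have e : D (x + J x) (J x - x) = 2 * D x (J x) := by
      simp only [map_add, map_sub, add_apply, hD.self_eq_zero, hD.neg_swap x (J x)]
      ring
    rw [map_smul, map_smul, smul_apply, e, smul_eq_mul, smul_eq_mul]
    positivity

lemma tendsto_sphere (hJ : IsConjugation D J) (hD : IsAreaForm D) [FiniteDimensional ℝ X] {x : X}
    (hx : ‖x‖ = 1) : Tendsto J (𝓝[sphere 0 1] x) (𝓝 (J x)) := by
  have : ProperSpace X := FiniteDimensional.proper_real X
  have hev : ∀ᶠ z in 𝓝[sphere 0 1] x, ‖z‖ = 1 :=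
    eventually_mem_nhdsWithin.mono fun z hz ↦ by simpa using hz
  refine (isCompact_sphere (0 : X) 1).tendsto_nhds_of_unique_mapClusterPt
    (hev.mono fun z hz ↦ by simpa using hJ.norm_eq z hz) fun y hy hc ↦ ?_
  obtain ⟨U, hU, hUy⟩ := mapClusterPt_iff_ultrafilter.1 hc
  have hid : Tendsto (fun z : X ↦ z) U (𝓝 x) := hU.trans nhdsWithin_le_nhds
  have hevU : ∀ᶠ z in (U : Filter X), ‖z‖ = 1 := hU hev
  refine (hJ.eq_of_isosceles hD hx (by simpa using hy) ?_ ?_).symm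
  · refine tendsto_nhds_unique_of_eventuallyEq (hid.add hUy).norm (hid.sub hUy).norm ?_
    exact hevU.mono fun z hz ↦ hJ.isosceles z hz
  · have hcont : Continuous fun p : X × X ↦ D p.1 p.2 := by fun_prop
    exact ge_of_tendsto ((hcont.tendsto (x, y)).comp (hid.prodMk_nhds hUy))
      (hevU.mono fun z hz ↦ (hJ.pos z hz).le)

lemma area_eq (hJ : IsConjugation D J) (hD : IsAreaForm D) (hdim : Module.finrank ℝ X = 2)
    {x z : X} (hx : ‖x‖ = 1) (hz : ‖z‖ = 1) : D x (J x) = D z (J z) := by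
  have : FiniteDimensional ℝ X := Module.finite_of_finrank_eq_succ hdim
  refine eq_of_isLittleO_sphere hdim (f := fun x ↦ D x (J x)) (fun x hx ↦ ?_) hx hz
  have hev : ∀ᶠ z in 𝓝[sphere 0 1] x, ‖z‖ = 1 :=
    eventually_mem_nhdsWithin.mono fun z hz ↦ by simpa using hz
  have hbound : (fun z ↦ D z (J z) - D x (J x)) =O[𝓝[sphere 0 1] x]
      fun z ↦ ‖J z - J x‖ * ‖z - x‖ := by
    refine Asymptotics.IsBigO.of_bound ‖D‖ (hev.mono fun z hz ↦ ?_)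
    have hE := D.le_opNorm₂ (z - x) (J z - J x)
    have h1 := (le_abs_self _).trans (hJ.abs_le x hx z)
    have h2 := (le_abs_self _).trans (hJ.abs_le z hz x)
    have h3 := (le_abs_self _).trans (hJ.abs_le_left hD hx (J z))
    have h4 := (le_abs_self _).trans (hJ.abs_le_left hD hz (J x))
    rw [hz, mul_one] at h1
    rw [hx, mul_one] at h2
    rw [hJ.norm_eq z hz, mul_one] at h3
    rw [hJ.norm_eq x hx, mul_one] at h4
    have h5 := (le_abs_self _).trans hE
    simp only [map_sub, sub_apply] at h5
    rw [norm_mul, norm_norm, norm_norm, Real.norm_eq_abs, _root_.abs_le]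
    constructor <;> linarith
  refine hbound.trans_isLittleO ?_
  have ht : Tendsto (fun z ↦ ‖J z - J x‖) (𝓝[sphere 0 1] x) (𝓝 0) :=
    tendsto_iff_norm_sub_tendsto_zero.1 (hJ.tendsto_sphere hD hx)
  have h1 := ((Asymptotics.isLittleO_one_iff ℝ).2 ht).mul_isBigO
    (Asymptotics.isBigO_refl (fun z ↦ ‖z - x‖) (𝓝[sphere 0 1] x))
  simpa using h1

lemma norm_add_sq (hJ : IsConjugation D J) (hD : IsAreaForm D)
    (h1 : ∀ x, ‖x‖ = 1 → D x (J x) = 1) {x : X} (hx : ‖x‖ = 1) :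
    ‖x + J x‖⁻¹ * ‖x + J x‖⁻¹ = 1 / 2 := by
  have h := h1 _ (hJ.norm_diagonal hx)
  rw [hJ.apply_diagonal hD hx] at h
  simp only [map_smul, smul_apply, smul_eq_mul, map_add, map_sub, add_apply, hD.self_eq_zero,
    hD.neg_swap x (J x), h1 x hx] at h
  linarith

lemma norm_add_eq (hJ : IsConjugation D J) (hD : IsAreaForm D)
    (h1 : ∀ x, ‖x‖ = 1 → D x (J x) = 1) {x z : X} (hx : ‖x‖ = 1) (hz : ‖z‖ = 1) :
    ‖x + J x‖⁻¹ = ‖z + J z‖⁻¹ := by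
  refine (mul_self_inj (inv_nonneg.2 (norm_nonneg _)) (inv_nonneg.2 (norm_nonneg _))).1 ?_
  rw [hJ.norm_add_sq hD h1 hx, hJ.norm_add_sq hD h1 hz]

lemma apply_apply_sub_le (hJ : IsConjugation D J) (hD : IsAreaForm D)
    (h1 : ∀ x, ‖x‖ = 1 → D x (J x) = 1) {x z : X} (hx : ‖x‖ = 1) (hz : ‖z‖ = 1) :
    D (J x) (J z) - D x z ≤ (1 - D x (J z)) + (1 - D z (J x)) := by
  have h := (le_abs_self _).trans
    (hJ.abs_le _ (hJ.norm_diagonal hz) (‖x + J x‖⁻¹ • (x + J x)))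
  rw [h1 _ (hJ.norm_diagonal hz), hJ.norm_diagonal hx, mul_one, hJ.apply_diagonal hD hz,
    ← hJ.norm_add_eq hD h1 hx hz, map_smul, map_smul, smul_apply, smul_eq_mul, smul_eq_mul,
    ← mul_assoc, hJ.norm_add_sq hD h1 hx] at h
  simp only [map_add, map_sub, add_apply, hD.neg_swap z (J x)] at h
  linarith

/-- The squared distance of `w` from the origin, computed in the frame `x, J x`, varies at most
quadratically with `x`. -/
lemma abs_frame_sub_le (hJ : IsConjugation D J) (hD : IsAreaForm D)
    (h1 : ∀ x, ‖x‖ = 1 → D x (J x) = 1) {x z : X} (hx : ‖x‖ = 1) (hz : ‖z‖ = 1)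
    (hsmall : (1 - D z (J x)) + |D x z| ≤ 1 / 2) (w : X) :
    |(D w (J z) ^ 2 + D w z ^ 2) - (D w (J x) ^ 2 + D w x ^ 2)| ≤
      20 * (|D w x| + |D w (J x)|) ^ 2 * D x z ^ 2 := by
  have hz_eq : D w z = D z (J x) * D w x + D x z * D w (J x) := by
    have h := congrArg (D w) (hD.smul_eq x (J x) z)
    simpa [h1 x hx] using h
  have hJz_eq : D w (J z) = -D (J x) (J z) * D w x + D x (J z) * D w (J x) := by
    have h := congrArg (D w) (hD.smul_eq x (J x) (J z))
    rw [hD.neg_swap (J x) (J z)] at h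
    simpa [h1 x hx] using h
  have hdet : D z (J x) * D x (J z) + D x z * D (J x) (J z) = 1 := by
    have h := congrArg (fun v ↦ D v (J z)) (hD.smul_eq x (J x) z)
    simp [h1 x hx, h1 z hz] at h
    linarith
  have hk1 := hJ.apply_apply_sub_le hD h1 hx hz
  have hk2 := hJ.apply_apply_sub_le hD h1 hz hx
  rw [hD.neg_swap x z, hD.neg_swap (J x) (J z)] at hk2
  have he1 := (le_abs_self _).trans (hJ.abs_le x hx z)
  have he2 := (le_abs_self _).trans (hJ.abs_le z hz x)
  rw [h1 x hx, hz, mul_one] at he1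
  rw [h1 z hz, hx, mul_one] at he2
  rw [hz_eq, hJz_eq]
  have h := abs_frame_defect_le (e₁ := 1 - D z (J x)) (e₂ := 1 - D x (J z)) (d := D x z)
    (h := D (J x) (J z) - D x z) (by linarith) (by linarith)
    (_root_.abs_le.2 ⟨by linarith, by linarith⟩) (by linarith) hsmall (D w x) (D w (J x))
  convert h using 2
  ring

theorem parallelogram (hJ : IsConjugation D J) (hD : IsAreaForm D)
    (hdim : Module.finrank ℝ X = 2) (h1 : ∀ x, ‖x‖ = 1 → D x (J x) = 1) (x y : X) :
    ‖x + y‖ ^ 2 + ‖x - y‖ ^ 2 = 2 * ‖x‖ ^ 2 + 2 * ‖y‖ ^ 2 := by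
  have hconst (w : X) {x z : X} (hx : ‖x‖ = 1) (hz : ‖z‖ = 1) :
      D w (J x) ^ 2 + D w x ^ 2 = D w (J z) ^ 2 + D w z ^ 2 := by
    refine eq_of_isLittleO_sphere hdim (f := fun x ↦ D w (J x) ^ 2 + D w x ^ 2)
      (fun x hx ↦ ?_) hx hz
    have hev : ∀ᶠ z in 𝓝[sphere 0 1] x, ‖z‖ = 1 :=
      eventually_mem_nhdsWithin.mono fun z hz ↦ by simpa using hz
    have hsmall : ∀ᶠ z in 𝓝[sphere 0 1] x, (1 - D z (J x)) + |D x z| < 1 / 2 := by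
      have hc : Continuous fun z ↦ (1 - D z (J x)) + |D x z| := by fun_prop
      have ht := hc.tendsto x
      simp only [h1 x hx, hD.self_eq_zero, sub_self, abs_zero, add_zero] at ht
      exact nhdsWithin_le_nhds (ht.eventually_lt_const (by norm_num))
    have hbound : (fun z ↦ (D w (J z) ^ 2 + D w z ^ 2) - (D w (J x) ^ 2 + D w x ^ 2))
        =O[𝓝[sphere 0 1] x] fun z ↦ ‖z - x‖ ^ 2 := by
      refine Asymptotics.IsBigO.of_bound
        (20 * (|D w x| + |D w (J x)|) ^ 2 * ‖D x‖ ^ 2) ?_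
      filter_upwards [hev, hsmall] with z hz hs
      refine (hJ.abs_frame_sub_le hD h1 hx hz hs.le w).trans ?_
      have h2 := (D x).le_opNorm (z - x)
      rw [map_sub, hD.self_eq_zero, sub_zero] at h2
      have h3 : D x z ^ 2 ≤ ‖D x‖ ^ 2 * ‖z - x‖ ^ 2 := by
        rw [← mul_pow, ← sq_abs]
        exact pow_le_pow_left₀ (abs_nonneg _) h2 2
      rw [norm_pow, norm_norm, mul_assoc _ (‖D x‖ ^ 2)]
      exact mul_le_mul_of_nonneg_left h3 (by positivity)
    refine hbound.trans_isLittleO ?_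
    exact (Asymptotics.isLittleO_pow_sub_sub x one_lt_two).mono nhdsWithin_le_nhds
  have : Nontrivial X := Module.nontrivial_of_finrank_pos (R := ℝ) (by omega)
  obtain ⟨p, hp⟩ := exists_norm_eq X zero_le_one
  have hnorm (w : X) : ‖w‖ ^ 2 = D w (J p) ^ 2 + D w p ^ 2 := by
    rcases eq_or_ne w 0 with rfl | hw
    · simp
    have hw' := norm_ne_zero_iff.2 hw
    have hu : ‖‖w‖⁻¹ • w‖ = 1 := by
      rw [norm_smul, norm_inv, norm_norm, inv_mul_cancel₀ hw']
    have hwu : ‖w‖ • ‖w‖⁻¹ • w = w := by rw [smul_smul, mul_inv_cancel₀ hw', one_smul]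
    rw [hconst w hp hu]
    have ha : D w (‖w‖⁻¹ • w) = 0 := by rw [map_smul, hD.self_eq_zero, smul_zero]
    have hb : D w (J (‖w‖⁻¹ • w)) = ‖w‖ := by
      have h := h1 _ hu
      rw [map_smul, smul_apply, smul_eq_mul] at h
      rw [← mul_right_inj' (inv_ne_zero hw'), h, inv_mul_cancel₀ hw']
    rw [ha, hb]; ring
  simp only [hnorm, map_add, map_sub, add_apply, sub_apply]
  ring

end IsConjugation

end TwoDimensional

/-- In a 2-dimensional normed space, if every pair of Birkhoff
orthogonal unit vectors is isosceles orthogonal, then the norm satisfies the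
parallelogram law, i.e. is induced by an inner product. -/
theorem stmt_15 {X : Type*} [NormedAddCommGroup X] [NormedSpace ℝ X]
    (hdim : Module.finrank ℝ X = 2)
    (H : ∀ x y : X, ‖x‖ = 1 → ‖y‖ = 1 →
      (∀ t : ℝ, ‖x‖ ≤ ‖x + t • y‖) → ‖x + y‖ = ‖x - y‖) :
    ∀ x y : X, ‖x + y‖^2 + ‖x - y‖^2 = 2*‖x‖^2 + 2*‖y‖^2 := by
  obtain ⟨D, hD⟩ := exists_isAreaForm hdim
  obtain ⟨J, hJ⟩ := hD.exists_isConjugation H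
  have : Nontrivial X := Module.nontrivial_of_finrank_pos (R := ℝ) (by omega)
  obtain ⟨p, hp⟩ := exists_norm_eq X zero_le_one
  have hc : 0 < (D p (J p))⁻¹ := inv_pos.2 (hJ.pos p hp)
  refine (hJ.const_smul hc).parallelogram (hD.const_smul hc.ne') hdim fun x hx ↦ ?_
  rw [smul_apply, smul_apply, smul_eq_mul, hJ.area_eq hD hdim hx hp,
    inv_mul_cancel₀ (hJ.pos p hp).ne']
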